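/- For every ε₀ ∈ (0,1) there exists a constant c₀ > 0 (depending only on ε₀ and on γ) such that for every positive integer m which is a sum of two squares and satisfies |τ̂_m(4)| < 1 − ε₀, and for all t₁, t₂ ∈ [0,L] with 0 < |t₂ − t₁| < c₀/√m, the symmetric 4×4 matrix Σ(t₁,t₂) with rows [1, r, 0, r₂], [r, 1, r₁, 0], [0, r₁, 2π²m, r₁₂], [r₂, 0, r₁₂, 2π²m] (where r, r₁, r₂, r₁₂ are evaluated at (t₁,t₂)) is nonsingular, i.e. det Σ(t₁,t₂) > 0. -/

import Mathlib

open MeasureTheory ProbabilityTheory Real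

noncomputable section

/-- The set of lattice points on the circle of radius `√m`:
`E = {μ ∈ ℤ² : μ₁² + μ₂² = m}` (all solutions satisfy `|μᵢ| ≤ m`). -/
def latticeSet (m : ℕ) : Finset (ℤ × ℤ) :=
  (Finset.Icc (-(m : ℤ)) (m : ℤ) ×ˢ Finset.Icc (-(m : ℤ)) (m : ℤ)).filter
    (fun μ => μ.1 ^ 2 + μ.2 ^ 2 = (m : ℤ))

/-- `N = #E`, the number of lattice points on the circle of radius `√m`. -/
def latN (m : ℕ) : ℕ := (latticeSet m).card

/-- The covariance function of the wave restricted to the curve: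
`r(t₁,t₂) = N⁻¹ ∑_{μ ∈ E} cos(2π⟨μ, γ(t₁) − γ(t₂)⟩)`. -/
def covFn (m : ℕ) (γ : ℝ → ℝ × ℝ) (t₁ t₂ : ℝ) : ℝ :=
  ((latN m : ℝ))⁻¹ *
    ∑ μ ∈ latticeSet m,
      Real.cos (2 * π * ((μ.1 : ℝ) * (γ t₁ - γ t₂).1 + (μ.2 : ℝ) * (γ t₁ - γ t₂).2))

/-- `r₁ = ∂r/∂t₁`. -/
def covFn1 (m : ℕ) (γ : ℝ → ℝ × ℝ) (t₁ t₂ : ℝ) : ℝ :=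
  deriv (fun s => covFn m γ s t₂) t₁

/-- `r₂ = ∂r/∂t₂`. -/
def covFn2 (m : ℕ) (γ : ℝ → ℝ × ℝ) (t₁ t₂ : ℝ) : ℝ :=
  deriv (fun s => covFn m γ t₁ s) t₂

/-- `r₁₂ = ∂²r/∂t₁∂t₂`. -/
def covFn12 (m : ℕ) (γ : ℝ → ℝ × ℝ) (t₁ t₂ : ℝ) : ℝ :=
  deriv (fun s => deriv (fun u => covFn m γ s u) t₂) t₁

/-- The fourth Fourier coefficient of the angular measure:
`τ̂_m(4) = (N m²)⁻¹ ∑_{μ ∈ E} (μ₁⁴ − 6 μ₁² μ₂² + μ₂⁴)`. -/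
def tauHat4 (m : ℕ) : ℝ :=
  ((latN m : ℝ) * (m : ℝ) ^ 2)⁻¹ *
    ∑ μ ∈ latticeSet m,
      ((μ.1 : ℝ) ^ 4 - 6 * (μ.1 : ℝ) ^ 2 * (μ.2 : ℝ) ^ 2 + (μ.2 : ℝ) ^ 4)

/-- The phase `2π⟨μ, v⟩`. -/
def phase (μ : ℤ × ℤ) (v : ℝ × ℝ) : ℝ := 2 * π * ((μ.1 : ℝ) * v.1 + (μ.2 : ℝ) * v.2)

lemma mem_latticeSet {m : ℕ} {μ : ℤ × ℤ} :
    μ ∈ latticeSet m ↔ μ.1 ^ 2 + μ.2 ^ 2 = (m : ℤ) := by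
  simp only [latticeSet, Finset.mem_filter, Finset.mem_product, Finset.mem_Icc,
    and_iff_right_iff_imp]
  intro h
  have aux : ∀ x : ℤ, x ^ 2 ≤ m → -(m : ℤ) ≤ x ∧ x ≤ m := fun x hx =>
    abs_le.1 <| (Int.le_self_sq _).trans (by rwa [sq_abs])
  exact ⟨aux _ (by nlinarith [sq_nonneg μ.2]), aux _ (by nlinarith [sq_nonneg μ.1])⟩

lemma neg_fst_mem_latticeSet {m : ℕ} {μ : ℤ × ℤ} (h : μ ∈ latticeSet m) :
    (-μ.1, μ.2) ∈ latticeSet m := by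
  simpa [mem_latticeSet] using h

lemma swap_mem_latticeSet {m : ℕ} {μ : ℤ × ℤ} (h : μ ∈ latticeSet m) :
    (μ.2, μ.1) ∈ latticeSet m := by
  simpa [mem_latticeSet, add_comm] using h

lemma sum_latticeSet_mul (m : ℕ) :
    ∑ μ ∈ latticeSet m, (μ.1 : ℝ) * (μ.2 : ℝ) = 0 := by
  have h : ∑ μ ∈ latticeSet m, (μ.1 : ℝ) * (μ.2 : ℝ) =
      ∑ μ ∈ latticeSet m, -((μ.1 : ℝ) * (μ.2 : ℝ)) :=
    Finset.sum_nbij' (fun μ => (-μ.1, μ.2)) (fun μ => (-μ.1, μ.2))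
      (fun _ => neg_fst_mem_latticeSet) (fun _ => neg_fst_mem_latticeSet)
      (by simp) (by simp) (by simp)
  rw [Finset.sum_neg_distrib] at h
  linarith

lemma sum_latticeSet_fst_sq (m : ℕ) :
    ∑ μ ∈ latticeSet m, (μ.1 : ℝ) ^ 2 = latN m * m / 2 := by
  have hswap : ∑ μ ∈ latticeSet m, (μ.1 : ℝ) ^ 2 = ∑ μ ∈ latticeSet m, (μ.2 : ℝ) ^ 2 :=
    Finset.sum_nbij' (fun μ => (μ.2, μ.1)) (fun μ => (μ.2, μ.1))
      (fun _ => swap_mem_latticeSet) (fun _ => swap_mem_latticeSet)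
      (by simp) (by simp) (by simp)
  have hadd : ∑ μ ∈ latticeSet m, ((μ.1 : ℝ) ^ 2 + (μ.2 : ℝ) ^ 2) = latN m * m := by
    rw [Finset.sum_congr rfl fun μ hμ =>
      (by exact_mod_cast mem_latticeSet.1 hμ : (μ.1 : ℝ) ^ 2 + (μ.2 : ℝ) ^ 2 = m)]
    simp [latN]
  rw [Finset.sum_add_distrib] at hadd
  linarith

lemma sum_latticeSet_snd_sq (m : ℕ) :
    ∑ μ ∈ latticeSet m, (μ.2 : ℝ) ^ 2 = latN m * m / 2 := by
  rw [← sum_latticeSet_fst_sq]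
  exact Finset.sum_nbij' (fun μ => (μ.2, μ.1)) (fun μ => (μ.2, μ.1))
    (fun _ => swap_mem_latticeSet) (fun _ => swap_mem_latticeSet)
    (by simp) (by simp) (by simp)

lemma sum_phase_sq (m : ℕ) {v : ℝ × ℝ} (hv : v.1 ^ 2 + v.2 ^ 2 = 1) :
    ∑ μ ∈ latticeSet m, phase μ v ^ 2 = latN m * (2 * π ^ 2 * m) := by
  have h : ∀ μ : ℤ × ℤ, phase μ v ^ 2 = 4 * π ^ 2 * v.1 ^ 2 * (μ.1 : ℝ) ^ 2 +
      8 * π ^ 2 * v.1 * v.2 * ((μ.1 : ℝ) * μ.2) + 4 * π ^ 2 * v.2 ^ 2 * (μ.2 : ℝ) ^ 2 := by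
    intro μ; unfold phase; ring
  simp_rw [h, Finset.sum_add_distrib, ← Finset.mul_sum, sum_latticeSet_mul,
    sum_latticeSet_fst_sq, sum_latticeSet_snd_sq]
  linear_combination (2 * π ^ 2 * latN m * m) * hv

lemma exists_mem_latticeSet_mul_ne_zero {m : ℕ} (hm : 0 < m) (hN : 0 < latN m)
    (hτ : tauHat4 m < 1) : ∃ μ ∈ latticeSet m, (μ.1 : ℝ) * μ.2 ≠ 0 := by
  by_contra! h
  refine hτ.ne ?_
  have hsum : ∀ μ ∈ latticeSet m, ((μ.1 : ℝ) ^ 4 - 6 * (μ.1 : ℝ) ^ 2 * (μ.2 : ℝ) ^ 2 +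
      (μ.2 : ℝ) ^ 4) = (m : ℝ) ^ 2 := by
    intro μ hμ
    have h1 : (μ.1 : ℝ) ^ 2 + (μ.2 : ℝ) ^ 2 = m := by exact_mod_cast mem_latticeSet.1 hμ
    rw [← h1]
    linear_combination (-8 * (μ.1 : ℝ) * μ.2) * h μ hμ
  have hm' : (m : ℝ) ≠ 0 := by positivity
  have hN' : (latN m : ℝ) ≠ 0 := by positivity
  rw [tauHat4, Finset.sum_congr rfl hsum, Finset.sum_const, nsmul_eq_mul, ← latN]
  exact inv_mul_cancel₀ (by positivity)

lemma exists_mem_latticeSet_sq_ne_sq {m : ℕ} (hm : 0 < m) (hN : 0 < latN m)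
    (hτ : -1 < tauHat4 m) : ∃ μ ∈ latticeSet m, (μ.1 : ℝ) ^ 2 - (μ.2 : ℝ) ^ 2 ≠ 0 := by
  by_contra! h
  refine hτ.ne' ?_
  have hsum : ∀ μ ∈ latticeSet m, ((μ.1 : ℝ) ^ 4 - 6 * (μ.1 : ℝ) ^ 2 * (μ.2 : ℝ) ^ 2 +
      (μ.2 : ℝ) ^ 4) = -(m : ℝ) ^ 2 := by
    intro μ hμ
    have h1 : (μ.1 : ℝ) ^ 2 + (μ.2 : ℝ) ^ 2 = m := by exact_mod_cast mem_latticeSet.1 hμ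
    rw [← h1]
    linear_combination (2 * ((μ.1 : ℝ) ^ 2 - (μ.2 : ℝ) ^ 2)) * h μ hμ
  have hm' : (m : ℝ) ≠ 0 := by positivity
  have hN' : (latN m : ℝ) ≠ 0 := by positivity
  rw [tauHat4, Finset.sum_congr rfl hsum, Finset.sum_const, nsmul_eq_mul, ← latN]
  field_simp

/-- A `C¹` plane curve with nonvanishing derivative on a compact interval is injective at small
scales, uniformly on the interval. -/
lemma exists_forall_abs_sub_lt_ne {g : ℝ → ℝ × ℝ} (hg : ContDiff ℝ 1 g) {L : ℝ}
    (h0 : ∀ t ∈ Set.Icc (0 : ℝ) L, deriv g t ≠ 0) :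
    ∃ δ > 0, ∀ s ∈ Set.Icc (0 : ℝ) L, ∀ t ∈ Set.Icc (0 : ℝ) L, s ≠ t → |t - s| < δ →
      g s ≠ g t := by
  rcases (Set.Icc (0 : ℝ) L).eq_empty_or_nonempty with hE | hE
  · exact ⟨1, one_pos, by simp [hE]⟩
  have hcont : Continuous (deriv g) := hg.continuous_deriv le_rfl
  have hdiff : ∀ t, HasDerivAt g (deriv g t) t := fun t =>
    (hg.differentiable one_ne_zero t).hasDerivAt
  obtain ⟨x, hx, hmin⟩ := isCompact_Icc.exists_isMinOn hE hcont.norm.continuousOn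
  have hη : 0 < ‖deriv g x‖ := norm_pos_iff.2 (h0 x hx)
  obtain ⟨δ, hδ, huc⟩ := Metric.uniformContinuousOn_iff.1
    (isCompact_Icc.uniformContinuousOn_of_continuous (s := Set.Icc (0 : ℝ) L)
      hcont.continuousOn) _ hη
  have key : ∀ s ∈ Set.Icc (0 : ℝ) L, ∀ t ∈ Set.Icc (0 : ℝ) L, s < t → |t - s| < δ →
      g s ≠ g t := by
    intro s hs t ht hst hlt heq
    have hlarge : ‖deriv g x‖ ≤ ‖deriv g s‖ := hmin hs
    have hclose : ∀ ξ ∈ Set.Ioo s t, ‖deriv g s - deriv g ξ‖ < ‖deriv g x‖ := by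
      intro ξ hξ
      rw [← dist_eq_norm]
      refine huc s hs ξ ⟨hs.1.trans hξ.1.le, hξ.2.le.trans ht.2⟩ ?_
      rw [dist_comm, Real.dist_eq, abs_of_pos (sub_pos.2 hξ.1)]
      rw [abs_of_pos (sub_pos.2 hst)] at hlt
      linarith [hξ.2]
    rw [Prod.norm_def (deriv g s), le_max_iff] at hlarge
    rcases hlarge with hl | hl
    · obtain ⟨ξ, hξ, h⟩ := exists_hasDerivAt_eq_zero (f := fun u => (g u).1) hst
        (hg.continuous.fst.continuousOn) (congrArg Prod.fst heq)
        (fun u _ => hasFDerivAt_fst.comp_hasDerivAt u (hdiff u))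
      have h' : (deriv g ξ).1 = 0 := h
      have := (norm_fst_le _).trans_lt (hclose ξ hξ)
      rw [Prod.fst_sub, h', sub_zero] at this
      exact this.not_ge hl
    · obtain ⟨ξ, hξ, h⟩ := exists_hasDerivAt_eq_zero (f := fun u => (g u).2) hst
        (hg.continuous.snd.continuousOn) (congrArg Prod.snd heq)
        (fun u _ => hasFDerivAt_snd.comp_hasDerivAt u (hdiff u))
      have h' : (deriv g ξ).2 = 0 := h
      have := (norm_snd_le _).trans_lt (hclose ξ hξ)
      rw [Prod.snd_sub, h', sub_zero] at this
      exact this.not_ge hl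
  refine ⟨δ, hδ, fun s hs t ht hne hlt => ?_⟩
  rcases hne.lt_or_gt with h | h
  · exact key s hs t ht h hlt
  · exact (key t ht s hs h (by rwa [abs_sub_comm])).symm

lemma hasDerivAt_phase {g : ℝ → ℝ × ℝ} {g' : ℝ × ℝ} {t : ℝ} (μ : ℤ × ℤ)
    (hg : HasDerivAt g g' t) : HasDerivAt (fun s => phase μ (g s)) (phase μ g') t := by
  have h1 : HasDerivAt (fun s => (g s).1) g'.1 t :=
    (hasFDerivAt_fst (𝕜 := ℝ) (p := g t)).comp_hasDerivAt t hg
  have h2 : HasDerivAt (fun s => (g s).2) g'.2 t :=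
    (hasFDerivAt_snd (𝕜 := ℝ) (p := g t)).comp_hasDerivAt t hg
  exact ((h1.const_mul (μ.1 : ℝ)).add (h2.const_mul (μ.2 : ℝ))).const_mul (2 * π)

lemma covFn_eq (m : ℕ) (γ : ℝ → ℝ × ℝ) (t₁ t₂ : ℝ) :
    covFn m γ t₁ t₂ =
      (latN m : ℝ)⁻¹ * ∑ μ ∈ latticeSet m, cos (phase μ (γ t₁ - γ t₂)) := rfl

lemma phase_neg (μ : ℤ × ℤ) (v : ℝ × ℝ) : phase μ (-v) = -phase μ v := by
  simp only [phase, Prod.fst_neg, Prod.snd_neg]; ring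

lemma covFn1_eq (m : ℕ) {γ : ℝ → ℝ × ℝ} (hγ : Differentiable ℝ γ) (t₁ t₂ : ℝ) :
    covFn1 m γ t₁ t₂ = (latN m : ℝ)⁻¹ *
      ∑ μ ∈ latticeSet m, -sin (phase μ (γ t₁ - γ t₂)) * phase μ (deriv γ t₁) :=
  ((HasDerivAt.fun_sum fun μ _ =>
    (hasDerivAt_phase μ ((hγ t₁).hasDerivAt.sub_const (γ t₂))).cos).const_mul _).deriv

lemma covFn2_eq (m : ℕ) {γ : ℝ → ℝ × ℝ} (hγ : Differentiable ℝ γ) (t₁ t₂ : ℝ) :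
    covFn2 m γ t₁ t₂ = (latN m : ℝ)⁻¹ *
      ∑ μ ∈ latticeSet m, sin (phase μ (γ t₁ - γ t₂)) * phase μ (deriv γ t₂) := by
  refine (((HasDerivAt.fun_sum fun μ _ =>
    (hasDerivAt_phase μ ((hγ t₂).hasDerivAt.const_sub (γ t₁))).cos).const_mul _).deriv).trans ?_
  simp only [phase_neg, neg_mul_neg]

lemma covFn12_eq (m : ℕ) {γ : ℝ → ℝ × ℝ} (hγ : Differentiable ℝ γ) (t₁ t₂ : ℝ) :
    covFn12 m γ t₁ t₂ = (latN m : ℝ)⁻¹ * ∑ μ ∈ latticeSet m,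
      cos (phase μ (γ t₁ - γ t₂)) * phase μ (deriv γ t₁) * phase μ (deriv γ t₂) := by
  have h : (fun s => deriv (fun u => covFn m γ s u) t₂) = fun s => (latN m : ℝ)⁻¹ *
      ∑ μ ∈ latticeSet m, sin (phase μ (γ s - γ t₂)) * phase μ (deriv γ t₂) :=
    funext fun s => covFn2_eq m hγ s t₂
  rw [covFn12, h]
  exact ((HasDerivAt.fun_sum fun μ _ => ((hasDerivAt_phase μ
    ((hγ t₁).hasDerivAt.sub_const (γ t₂))).sin).mul_const _).const_mul _).deriv

/-- If `c² ⟨μ, u⟩² - d² ⟨μ, v⟩²` is constant on the lattice points and `u ≠ ±v` are unit vectors,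
then `c = d = 0`. -/
lemma eq_zero_of_phase_sq_sub_const {m : ℕ}
    (hmul : ∃ μ ∈ latticeSet m, (μ.1 : ℝ) * μ.2 ≠ 0)
    (hsq : ∃ μ ∈ latticeSet m, (μ.1 : ℝ) ^ 2 - (μ.2 : ℝ) ^ 2 ≠ 0)
    {u v : ℝ × ℝ} (hu : u.1 ^ 2 + u.2 ^ 2 = 1) (hv : v.1 ^ 2 + v.2 ^ 2 = 1)
    (huv : u ≠ v) (huv' : u ≠ -v) {c d k : ℝ}
    (h : ∀ μ ∈ latticeSet m, c ^ 2 * phase μ u ^ 2 - d ^ 2 * phase μ v ^ 2 = k) :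
    c = 0 ∧ d = 0 := by
  have hπ : π ^ 2 ≠ 0 := by positivity
  have hcross : c ^ 2 * (u.1 * u.2) = d ^ 2 * (v.1 * v.2) := by
    obtain ⟨μ, hμ, hne⟩ := hmul
    have h1 := h μ hμ
    have h2 := h _ (neg_fst_mem_latticeSet hμ)
    simp only [phase, Int.cast_neg] at h1 h2
    refine mul_left_cancel₀ (mul_ne_zero hπ hne) ?_
    linear_combination (h1 - h2) / 16
  have hdiag : c ^ 2 * (u.1 ^ 2 - u.2 ^ 2) = d ^ 2 * (v.1 ^ 2 - v.2 ^ 2) := by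
    obtain ⟨μ, hμ, hne⟩ := hsq
    have h1 := h μ hμ
    have h2 := h _ (swap_mem_latticeSet hμ)
    simp only [phase] at h1 h2
    refine mul_left_cancel₀ (mul_ne_zero hπ hne) ?_
    linear_combination (h1 - h2) / 4
  have hcd4 : (c ^ 2) ^ 2 = (d ^ 2) ^ 2 := by
    have e1 : (u.1 ^ 2 - u.2 ^ 2) ^ 2 + 4 * (u.1 * u.2) ^ 2 = 1 := by
      linear_combination (u.1 ^ 2 + u.2 ^ 2 + 1) * hu
    have e2 : (v.1 ^ 2 - v.2 ^ 2) ^ 2 + 4 * (v.1 * v.2) ^ 2 = 1 := by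
      linear_combination (v.1 ^ 2 + v.2 ^ 2 + 1) * hv
    calc (c ^ 2) ^ 2 = (c ^ 2 * (u.1 ^ 2 - u.2 ^ 2)) ^ 2 + 4 * (c ^ 2 * (u.1 * u.2)) ^ 2 := by
          linear_combination -(c ^ 2) ^ 2 * e1
      _ = (d ^ 2) ^ 2 := by rw [hcross, hdiag]; linear_combination (d ^ 2) ^ 2 * e2
  have hcd : c ^ 2 = d ^ 2 := (sq_eq_sq₀ (sq_nonneg c) (sq_nonneg d)).1 hcd4
  by_cases hc : c = 0
  · exact ⟨hc, by simpa [hc] using hcd.symm⟩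
  exfalso
  rw [← hcd] at hcross hdiag
  have hc2 : c ^ 2 ≠ 0 := pow_ne_zero 2 hc
  have e1 := mul_left_cancel₀ hc2 hcross
  have e2 := mul_left_cancel₀ hc2 hdiag
  have hfst : u.1 ^ 2 = v.1 ^ 2 := by linear_combination (hu - hv + e2) / 2
  have hinner : (u.1 * v.1 + u.2 * v.2) ^ 2 = 1 := by
    have hsnd : u.2 ^ 2 = v.2 ^ 2 := by linear_combination (hu - hv - e2) / 2
    have : (u.1 * v.1 + u.2 * v.2) ^ 2 =
        u.1 ^ 2 * v.1 ^ 2 + u.2 ^ 2 * v.2 ^ 2 + 2 * (u.1 * u.2) * (v.1 * v.2) := by ring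
    rw [this, hfst, hsnd, e1]
    linear_combination (v.1 ^ 2 + v.2 ^ 2 + 1) * hv
  rcases mul_self_eq_one_iff.1 ((sq _).symm.trans hinner) with hi | hi
  · refine huv (Prod.ext ?_ ?_) <;>
      nlinarith [sq_nonneg (u.1 - v.1), sq_nonneg (u.2 - v.2)]
  · refine huv' (Prod.ext ?_ ?_) <;> simp only [Prod.fst_neg, Prod.snd_neg] <;>
      nlinarith [sq_nonneg (u.1 + v.1), sq_nonneg (u.2 + v.2)]

/-- The values and derivatives at two points of the restricted complex exponentials are linearly
independent over the reals; `u`, `v` are the tangents at the two points and `w` is the chord. -/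
lemma eq_zero_of_forall_phase {m : ℕ}
    (hmul : ∃ μ ∈ latticeSet m, (μ.1 : ℝ) * μ.2 ≠ 0)
    (hsq : ∃ μ ∈ latticeSet m, (μ.1 : ℝ) ^ 2 - (μ.2 : ℝ) ^ 2 ≠ 0)
    {u v w : ℝ × ℝ} (hu : u.1 ^ 2 + u.2 ^ 2 = 1) (hv : v.1 ^ 2 + v.2 ^ 2 = 1)
    (huv : u ≠ v) (huv' : u ≠ -v) (hw : w ≠ 0) (hsmall : ∀ μ ∈ latticeSet m, |phase μ w| < π)
    {a b c d : ℝ}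
    (hre : ∀ μ ∈ latticeSet m,
      a + b * cos (phase μ w) + d * phase μ v * sin (phase μ w) = 0)
    (him : ∀ μ ∈ latticeSet m,
      c * phase μ u - b * sin (phase μ w) + d * phase μ v * cos (phase μ w) = 0) :
    a = 0 ∧ b = 0 ∧ c = 0 ∧ d = 0 := by
  obtain ⟨rfl, rfl⟩ : c = 0 ∧ d = 0 := by
    refine eq_zero_of_phase_sq_sub_const hmul hsq hu hv huv huv' (k := b ^ 2 - a ^ 2) ?_
    intro μ hμ
    have ha : a = -(b * cos (phase μ w) + d * phase μ v * sin (phase μ w)) := by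
      linear_combination hre μ hμ
    have hc : c * phase μ u = b * sin (phase μ w) - d * phase μ v * cos (phase μ w) := by
      linear_combination him μ hμ
    rw [← mul_pow, hc, ha]
    linear_combination (b ^ 2 + d ^ 2 * phase μ v ^ 2) * sin_sq_add_cos_sq (phase μ w)
  have hb : b = 0 := by
    by_contra hb
    have hzero : ∀ μ ∈ latticeSet m, (μ.1 : ℝ) * w.1 + (μ.2 : ℝ) * w.2 = 0 := by
      intro μ hμ
      have hsin : sin (phase μ w) = 0 := by simpa [hb] using him μ hμ
      have hlt := abs_lt.1 (hsmall μ hμ)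
      have := (sin_eq_zero_iff_of_lt_of_lt hlt.1 hlt.2).1 hsin
      simpa [phase, pi_ne_zero] using this
    obtain ⟨μ, hμ, hne⟩ := hmul
    have h1 := hzero μ hμ
    have h2 := hzero _ (neg_fst_mem_latticeSet hμ)
    push_cast at h2
    have e1 : (μ.1 : ℝ) * w.1 = 0 := by linear_combination (h1 - h2) / 2
    have e2 : (μ.2 : ℝ) * w.2 = 0 := by linear_combination (h1 + h2) / 2
    exact hw (Prod.ext ((mul_eq_zero.1 e1).resolve_left (left_ne_zero_of_mul hne))
      ((mul_eq_zero.1 e2).resolve_left (right_ne_zero_of_mul hne)))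
  obtain ⟨μ, hμ, -⟩ := hmul
  exact ⟨by simpa [hb] using hre μ hμ, hb, rfl, rfl⟩

lemma abs_phase_le {m : ℕ} {μ : ℤ × ℤ} (hμ : μ ∈ latticeSet m) {v : ℝ × ℝ} {h : ℝ}
    (h1 : |v.1| ≤ h) (h2 : |v.2| ≤ h) : |phase μ v| ≤ 4 * π * (√m * h) := by
  have hm : (μ.1 : ℝ) ^ 2 + (μ.2 : ℝ) ^ 2 = m := by exact_mod_cast mem_latticeSet.1 hμ
  have e1 : |(μ.1 : ℝ)| ≤ √m := abs_le_sqrt (by nlinarith [sq_nonneg (μ.2 : ℝ)])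
  have e2 : |(μ.2 : ℝ)| ≤ √m := abs_le_sqrt (by nlinarith [sq_nonneg (μ.1 : ℝ)])
  have hsum : |(μ.1 : ℝ) * v.1 + (μ.2 : ℝ) * v.2| ≤ √m * h + √m * h := by
    refine (abs_add_le _ _).trans ?_
    rw [abs_mul, abs_mul]
    gcongr
  rw [phase, abs_mul, abs_of_pos two_pi_pos]
  calc 2 * π * |(μ.1 : ℝ) * v.1 + (μ.2 : ℝ) * v.2| ≤ 2 * π * (√m * h + √m * h) := by gcongr
    _ = 4 * π * (√m * h) := by ring

lemma norm_le_one_of_sq_add_sq_eq_one {v : ℝ × ℝ} (hv : v.1 ^ 2 + v.2 ^ 2 = 1) : ‖v‖ ≤ 1 := by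
  rw [Prod.norm_def, max_le_iff, norm_eq_abs, norm_eq_abs, ← sq_le_one_iff_abs_le_one,
    ← sq_le_one_iff_abs_le_one]
  constructor <;> nlinarith [sq_nonneg v.1, sq_nonneg v.2]

lemma half_lt_norm_of_sq_add_sq_eq_one {v : ℝ × ℝ} (hv : v.1 ^ 2 + v.2 ^ 2 = 1) :
    1 / 2 < ‖v‖ := by
  by_contra! h
  have h1 := (norm_fst_le v).trans h
  have h2 := (norm_snd_le v).trans h
  rw [norm_eq_abs] at h1 h2
  have e1 := sq_le_sq' (abs_le.1 h1).1 (abs_le.1 h1).2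
  have e2 := sq_le_sq' (abs_le.1 h2).1 (abs_le.1 h2).2
  linarith

/-- Non-degeneracy of the covariance matrix `Σ(t₁,t₂)` near the diagonal. -/
theorem covariance_matrix_nondegenerate
    (L : ℝ) (hL : 0 < L) (γ : ℝ → ℝ × ℝ) (hγ : ContDiff ℝ (⊤ : ℕ∞) γ)
    (hunit : ∀ t ∈ Set.Icc (0:ℝ) L, (deriv γ t).1 ^ 2 + (deriv γ t).2 ^ 2 = 1)
    (hcurv : ∀ t ∈ Set.Icc (0:ℝ) L, deriv (deriv γ) t ≠ 0) :
    ∀ ε₀ ∈ Set.Ioo (0:ℝ) 1, ∃ c₀ > 0, ∀ m : ℕ, 0 < m →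
      (∃ a b : ℤ, a ^ 2 + b ^ 2 = (m : ℤ)) →
      |tauHat4 m| < 1 - ε₀ →
      ∀ t₁ ∈ Set.Icc (0:ℝ) L, ∀ t₂ ∈ Set.Icc (0:ℝ) L, t₁ ≠ t₂ →
        |t₂ - t₁| < c₀ / Real.sqrt m →
        0 < (!![1, covFn m γ t₁ t₂, 0, covFn2 m γ t₁ t₂;
                covFn m γ t₁ t₂, 1, covFn1 m γ t₁ t₂, 0;
                0, covFn1 m γ t₁ t₂, 2 * π ^ 2 * m, covFn12 m γ t₁ t₂;
                covFn2 m γ t₁ t₂, 0, covFn12 m γ t₁ t₂, 2 * π ^ 2 * m] :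
              Matrix (Fin 4) (Fin 4) ℝ).det := by
  rintro ε₀ ⟨hε₀, -⟩
  have hdiff : Differentiable ℝ γ := hγ.differentiable (by simp)
  have hγ' : ContDiff ℝ 1 (deriv γ) :=
    (contDiff_infty_iff_deriv.1 hγ).2.of_le (by exact_mod_cast le_top)
  have hunit0 : ∀ t ∈ Set.Icc (0 : ℝ) L, deriv γ t ≠ 0 := fun t ht h0 => by
    simpa [h0] using hunit t ht
  obtain ⟨δ₁, hδ₁, hinj⟩ :=
    exists_forall_abs_sub_lt_ne (hγ.of_le (by exact_mod_cast le_top)) hunit0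
  obtain ⟨δ₂, hδ₂, hinj'⟩ := exists_forall_abs_sub_lt_ne hγ' hcurv
  obtain ⟨δ₃, hδ₃, huc⟩ := Metric.uniformContinuousOn_iff.1
    (isCompact_Icc.uniformContinuousOn_of_continuous (s := Set.Icc (0 : ℝ) L)
      hγ'.continuous.continuousOn) 1 one_pos
  refine ⟨min (min δ₁ δ₂) (min δ₃ (1 / 4)), by positivity, ?_⟩
  rintro m hm ⟨a₀, b₀, hab⟩ hτ t₁ ht₁ t₂ ht₂ hne hlt
  have hN : 0 < latN m := Finset.card_pos.2 ⟨(a₀, b₀), mem_latticeSet.2 hab⟩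
  have hτ' := abs_lt.1 hτ
  have hmul := exists_mem_latticeSet_mul_ne_zero hm hN (by linarith)
  have hsq := exists_mem_latticeSet_sq_ne_sq hm hN (by linarith)
  have hsqrt : 1 ≤ √(m : ℝ) := one_le_sqrt.2 (by exact_mod_cast hm)
  rw [lt_div_iff₀ (by linarith)] at hlt
  simp only [lt_min_iff] at hlt
  obtain ⟨⟨hlt₁, hlt₂⟩, hlt₃, hlt₄⟩ := hlt
  have hle : |t₂ - t₁| ≤ |t₂ - t₁| * √m := le_mul_of_one_le_right (abs_nonneg _) hsqrt
  have hw : γ t₁ - γ t₂ ≠ 0 := sub_ne_zero.2 (hinj t₁ ht₁ t₂ ht₂ hne (hle.trans_lt hlt₁))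
  have huv := hinj' t₁ ht₁ t₂ ht₂ hne (hle.trans_lt hlt₂)
  have huv' : deriv γ t₁ ≠ -deriv γ t₂ := by
    intro h
    have hd := huc t₂ ht₂ t₁ ht₁ (hle.trans_lt hlt₃)
    rw [dist_eq_norm, h, sub_neg_eq_add, ← two_smul ℝ, norm_smul, norm_two] at hd
    linarith [half_lt_norm_of_sq_add_sq_eq_one (hunit t₂ ht₂)]
  have hchord : ‖γ t₁ - γ t₂‖ ≤ |t₂ - t₁| := by
    have := (convex_Icc (0 : ℝ) L).norm_image_sub_le_of_norm_deriv_le (C := 1)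
      (fun x _ => hdiff x) (fun x hx => norm_le_one_of_sq_add_sq_eq_one (hunit x hx)) ht₂ ht₁
    rwa [one_mul, norm_eq_abs, abs_sub_comm] at this
  have hsmall : ∀ μ ∈ latticeSet m, |phase μ (γ t₁ - γ t₂)| < π := fun μ hμ =>
    calc |phase μ (γ t₁ - γ t₂)| ≤ 4 * π * (√m * |t₂ - t₁|) :=
          abs_phase_le hμ ((norm_fst_le _).trans hchord) ((norm_snd_le _).trans hchord)
      _ < 4 * π * (1 / 4) := by rw [mul_comm √(m : ℝ)]; gcongr
      _ = π := by ring
  refine Matrix.PosDef.det_pos (.of_dotProduct_mulVec_pos ?_ fun x hx => ?_)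
  · ext i j
    fin_cases i <;> fin_cases j <;> simp
  have hquad : ∑ μ ∈ latticeSet m,
      ((x 0 + x 1 * cos (phase μ (γ t₁ - γ t₂)) +
          x 3 * phase μ (deriv γ t₂) * sin (phase μ (γ t₁ - γ t₂))) ^ 2 +
        (x 2 * phase μ (deriv γ t₁) - x 1 * sin (phase μ (γ t₁ - γ t₂)) +
          x 3 * phase μ (deriv γ t₂) * cos (phase μ (γ t₁ - γ t₂))) ^ 2) =
      latN m * (x 0 ^ 2 + x 1 ^ 2 + (x 2 ^ 2 + x 3 ^ 2) * (2 * π ^ 2 * m) +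
        2 * x 0 * x 1 * covFn m γ t₁ t₂ + 2 * x 0 * x 3 * covFn2 m γ t₁ t₂ +
        2 * x 1 * x 2 * covFn1 m γ t₁ t₂ + 2 * x 2 * x 3 * covFn12 m γ t₁ t₂) := by
    have hN' : (latN m : ℝ) ≠ 0 := by positivity
    rw [covFn_eq, covFn1_eq m hdiff, covFn2_eq m hdiff, covFn12_eq m hdiff]
    calc _ = ∑ μ ∈ latticeSet m, ((x 0 ^ 2 + x 1 ^ 2) + x 2 ^ 2 * phase μ (deriv γ t₁) ^ 2 +
          x 3 ^ 2 * phase μ (deriv γ t₂) ^ 2 +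
          2 * x 0 * x 1 * cos (phase μ (γ t₁ - γ t₂)) +
          2 * x 0 * x 3 * (sin (phase μ (γ t₁ - γ t₂)) * phase μ (deriv γ t₂)) +
          2 * x 1 * x 2 * (-sin (phase μ (γ t₁ - γ t₂)) * phase μ (deriv γ t₁)) +
          2 * x 2 * x 3 * (cos (phase μ (γ t₁ - γ t₂)) * phase μ (deriv γ t₁) *
            phase μ (deriv γ t₂))) := by
          refine Finset.sum_congr rfl fun μ _ => ?_
          linear_combination (x 1 ^ 2 + x 3 ^ 2 * phase μ (deriv γ t₂) ^ 2) *
            sin_sq_add_cos_sq (phase μ (γ t₁ - γ t₂))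
      _ = _ := by
          simp only [Finset.sum_add_distrib, ← Finset.mul_sum, Finset.sum_const, nsmul_eq_mul,
            sum_phase_sq m (hunit t₁ ht₁), sum_phase_sq m (hunit t₂ ht₂)]
          rw [← latN]
          field_simp
          ring
  have hpos : 0 < ∑ μ ∈ latticeSet m,
      ((x 0 + x 1 * cos (phase μ (γ t₁ - γ t₂)) +
          x 3 * phase μ (deriv γ t₂) * sin (phase μ (γ t₁ - γ t₂))) ^ 2 +
        (x 2 * phase μ (deriv γ t₁) - x 1 * sin (phase μ (γ t₁ - γ t₂)) +
          x 3 * phase μ (deriv γ t₂) * cos (phase μ (γ t₁ - γ t₂))) ^ 2) := by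
    refine (Finset.sum_nonneg fun μ _ => by positivity).lt_of_ne' fun h0 => hx ?_
    rw [Finset.sum_eq_zero_iff_of_nonneg fun μ _ => by positivity] at h0
    obtain ⟨h0', h1', h2', h3'⟩ := eq_zero_of_forall_phase hmul hsq (hunit t₁ ht₁)
      (hunit t₂ ht₂) huv huv' hw hsmall
      (fun μ hμ => pow_eq_zero_iff two_ne_zero |>.1
        ((add_eq_zero_iff_of_nonneg (sq_nonneg _) (sq_nonneg _)).1 (h0 μ hμ)).1)
      (fun μ hμ => pow_eq_zero_iff two_ne_zero |>.1
        ((add_eq_zero_iff_of_nonneg (sq_nonneg _) (sq_nonneg _)).1 (h0 μ hμ)).2)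
    ext i
    fin_cases i <;> assumption
  rw [hquad] at hpos
  convert pos_of_mul_pos_right hpos (Nat.cast_nonneg _) using 1
  simp only [dotProduct, Matrix.mulVec, Fin.sum_univ_four, Pi.star_apply, star_trivial]
  simp
  ring

end
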